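/- arXiv:1008.4419 — 3 statements merged into one kernel-verified Lean document; each statement's English description precedes it below -/
import Mathlib

section
/- On X = Y = [0,1), let f₀(x) = x and f₁(x) = x + √2 (mod 1). Then the set S = Graph(f₀) ∪ Graph(f₁) ⊂ X × Y is acyclic. -/
/-- A set `S ⊆ X × Y` is **acyclic** if for every `k ≥ 2` distinct points
`x₁,…,x_k ∈ X` and distinct points `y₁,…,y_k ∈ Y`, at least one of the pairs
`(x₁,y₁), (x₁,y₂), (x₂,y₂), …, (x_{k-1},y_k), (x_k,y_k), (x_k,y₁)` lies outside `S`.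
Equivalently: one of the pairs `(xᵢ,yᵢ)` or `(xᵢ,y_{i+1})` (indices cyclic) avoids `S`.
(The quantification over `Fin (k+2)` realizes `k ≥ 2` and the cyclic successor.) -/
def Acyclic {X Y : Type*} (S : Set (X × Y)) : Prop :=
  ∀ (k : ℕ) (x : Fin (k + 2) → X) (y : Fin (k + 2) → Y),
    Function.Injective x → Function.Injective y →
    ∃ i : Fin (k + 2), (x i, y i) ∉ S ∨ (x i, y (i + 1)) ∉ S

/-- The map `f₁(x) = x + √2 (mod 1)` on `[0,1)`. -/
noncomputable def addSqrtTwoMod1 : Set.Ico (0 : ℝ) 1 → Set.Ico (0 : ℝ) 1 :=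
  fun x => ⟨Int.fract ((x : ℝ) + Real.sqrt 2), Int.fract_nonneg _, Int.fract_lt_one _⟩

theorem addSqrtTwoMod1_injective : Function.Injective addSqrtTwoMod1 := by
  intro a b hab
  obtain ⟨z, hz⟩ := Int.fract_eq_fract.mp (congrArg Subtype.val hab)
  have hz' : (a : ℝ) - b = z := by linarith
  have ha := a.2
  have hb := b.2
  have h₁ : (z : ℝ) < 1 := by linarith [ha.2, hb.1]
  have h₂ : (-1 : ℝ) < z := by linarith [ha.1, hb.2]
  norm_cast at h₁
  have h₂' : -1 < z := by exact_mod_cast h₂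
  obtain rfl : z = 0 := by omega
  exact Subtype.ext (by simpa [sub_eq_zero] using hz')

/-- The rotation by `√2` permutes no finite nonempty family of points of `[0,1)`. -/
theorem not_forall_apply_equiv_eq_addSqrtTwoMod1 {ι : Type*} [Fintype ι] [Nonempty ι]
    (e : ι ≃ ι) (y : ι → Set.Ico (0 : ℝ) 1) :
    ¬ ∀ i, y (e i) = addSqrtTwoMod1 (y i) := by
  intro h
  have hval (i : ι) : (y (e i) : ℝ) = y i + √2 - ⌊(y i : ℝ) + √2⌋ :=
    congrArg Subtype.val (h i)
  have hsum : ∑ i, (y (e i) : ℝ) = ∑ i, (y i : ℝ) :=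
    Equiv.sum_comp e fun i => (y i : ℝ)
  simp only [hval, Finset.sum_sub_distrib, Finset.sum_add_distrib, Finset.sum_const,
    Finset.card_univ, nsmul_eq_mul] at hsum
  have hirr : Irrational ((Fintype.card ι : ℝ) * √2) :=
    irrational_sqrt_two.natCast_mul Fintype.card_ne_zero
  refine hirr.ne_int (∑ i, ⌊(y i : ℝ) + √2⌋) ?_
  push_cast
  linarith

theorem Fin.iff_zero_of_forall_iff_add_one {k : ℕ} {p : Fin (k + 1) → Prop}
    (h : ∀ i, p i ↔ p (i + 1)) (i : Fin (k + 1)) : p i ↔ p 0 := by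
  induction i using Fin.induction with
  | zero => rfl
  | succ i ih => rw [← ih, h i.castSucc, Fin.coeSucc_eq_succ]

/-- On `X = Y = [0,1)`, with `f₀(x) = x` and `f₁(x) = x + √2 (mod 1)`, the set
`S = Graph(f₀) ∪ Graph(f₁)` is acyclic. -/
theorem acyclic_graph_union_graph_addSqrtTwo :
    Acyclic (({p | p.2 = p.1} ∪ {p | p.2 = addSqrtTwoMod1 p.1}) :
      Set (Set.Ico (0 : ℝ) 1 × Set.Ico (0 : ℝ) 1)) := by
  intro k x y hx hy
  by_contra! hS
  replace hS : ∀ i, (y i = x i ∨ y i = addSqrtTwoMod1 (x i)) ∧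
      (y (i + 1) = x i ∨ y (i + 1) = addSqrtTwoMod1 (x i)) := hS
  have hne (i : Fin (k + 2)) : i ≠ i + 1 := by simp
  have hxne (i : Fin (k + 2)) : x i ≠ x (i + 1) := hx.ne (hne i)
  have hyne (i : Fin (k + 2)) : y i ≠ y (i + 1) := hy.ne (hne i)
  have hstep (i : Fin (k + 2)) : y i = x i ↔ y (i + 1) = x (i + 1) := by
    have hf := addSqrtTwoMod1_injective.ne (hxne i)
    grind
  have hconst := Fin.iff_zero_of_forall_iff_add_one hstep
  by_cases h₀ : y 0 = x 0
  · refine not_forall_apply_equiv_eq_addSqrtTwoMod1 (Equiv.addRight 1) y fun i => ?_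
    have hi := (hconst i).mpr h₀
    change y (i + 1) = _
    grind
  · refine not_forall_apply_equiv_eq_addSqrtTwoMod1 (Equiv.addRight 1).symm y fun j => ?_
    obtain ⟨i, rfl⟩ := (Equiv.addRight (1 : Fin (k + 2))).surjective j
    rw [Equiv.symm_apply_apply]
    have hi := mt (hconst i).mp h₀
    change y i = addSqrtTwoMod1 (y (i + 1))
    grind
end

section
/- Let A and B be topological spaces and Z ⊂ A × B a closed set. If g: A × B → ℝ ∪ {−∞} is lower semi-continuous and B is σ-compact, then the function h(a) := inf { g(a,b) : b ∈ B, (a,b) ∈ Z } is Borel measurable on A (with the convention that the infimum over the empty set is +∞). -/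
open MeasureTheory

/-- Over a compact set `K`, the projection of a closed subset of `A × B` to `A` is closed. -/
theorem isClosed_setOf_exists_mem_of_isCompact {A B : Type*} [TopologicalSpace A]
    [TopologicalSpace B] {K : Set B} (hK : IsCompact K) {C : Set (A × B)} (hC : IsClosed C) :
    IsClosed {a : A | ∃ b ∈ K, (a, b) ∈ C} := by
  have : CompactSpace K := isCompact_iff_compactSpace.mp hK
  have hcont : Continuous fun p : A × K => (p.1, (p.2 : B)) := by fun_prop
  have himage := isClosedMap_fst_of_compactSpace _ (hC.preimage hcont)
  convert himage using 1
  ext a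
  simp

/-- The projection of a closed set along a σ-compact factor is a Borel set. -/
theorem measurableSet_setOf_exists_mem_of_isClosed {A B : Type*} [TopologicalSpace A]
    [TopologicalSpace B] [MeasurableSpace A] [BorelSpace A] [SigmaCompactSpace B]
    {C : Set (A × B)} (hC : IsClosed C) :
    MeasurableSet {a : A | ∃ b, (a, b) ∈ C} := by
  have heq : {a : A | ∃ b, (a, b) ∈ C} =
      ⋃ n, {a : A | ∃ b ∈ compactCovering B n, (a, b) ∈ C} := by
    ext a
    simp only [Set.mem_ofPred_eq, Set.mem_iUnion]
    constructor
    · rintro ⟨b, hb⟩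
      obtain ⟨n, hn⟩ := exists_mem_compactCovering b
      exact ⟨n, b, hn, hb⟩
    · rintro ⟨_, b, _, hb⟩
      exact ⟨b, hb⟩
  rw [heq]
  exact .iUnion fun n =>
    (isClosed_setOf_exists_mem_of_isCompact (isCompact_compactCovering B n) hC).measurableSet

/-- **A Borel measurability lemma** (Lemma A.4 of Chiappori–McCann–Nesheim).  Let `A` and
`B` be topological spaces and `Z ⊆ A × B` closed.  If `g : A × B → ℝ ∪ {-∞}` (modelled as
an `EReal`-valued function never equal to `+∞`) is lower semi-continuous and `B` is
σ-compact, then `h(a) := inf { g(a,b) : b ∈ B, (a,b) ∈ Z }` is Borel measurable on `A`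
(the infimum over the empty set being `+∞`). -/
theorem borel_measurable_inf_section
    {A B : Type*} [TopologicalSpace A] [TopologicalSpace B]
    [MeasurableSpace A] [BorelSpace A] [SigmaCompactSpace B]
    (Z : Set (A × B)) (hZ : IsClosed Z)
    (g : A × B → EReal) (hgtop : ∀ p, g p ≠ ⊤) (hg : LowerSemicontinuous g) :
    Measurable (fun a : A => ⨅ (b : B) (_ : (a, b) ∈ Z), g (a, b)) := by
  refine measurable_of_Iio fun t => ?_
  have heq : (fun a : A => ⨅ (b : B) (_ : (a, b) ∈ Z), g (a, b)) ⁻¹' Set.Iio t =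
      ⋃ (q : ℚ) (_ : ((q : ℝ) : EReal) < t),
        {a : A | ∃ b, (a, b) ∈ Z ∩ g ⁻¹' Set.Iic ((q : ℝ) : EReal)} := by
    ext a
    simp only [Set.mem_preimage, Set.mem_Iio, iInf_lt_iff, Set.mem_iUnion, Set.mem_ofPred_eq,
      Set.mem_inter_iff, Set.mem_Iic, exists_prop]
    constructor
    · rintro ⟨b, hb, hlt⟩
      obtain ⟨q, hq, hqt⟩ := EReal.lt_iff_exists_rat_btwn.mp hlt
      exact ⟨q, hqt, b, hb, hq.le⟩
    · rintro ⟨q, hqt, b, hb, hq⟩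
      exact ⟨b, hb, hq.trans_lt hqt⟩
  rw [heq]
  exact .iUnion fun q => .iUnion fun _ =>
    measurableSet_setOf_exists_mem_of_isClosed (hZ.inter (hg.isClosed_preimage _))
end

section
/- (Douglas–Lindenstrauss characterization.) Let X and Y be subsets of complete separable metric spaces equipped with Borel probability measures μ on X and ν on Y. A measure γ ∈ Γ(μ,ν) is extremal in Γ(μ,ν) if and only if the subspace { (x,y) ↦ u(x) + v(y) : u ∈ L¹(X,dμ), v ∈ L¹(Y,dν) } is dense in L¹(X × Y, dγ). -/
open MeasureTheory
open scoped NNReal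

/-- `Γ(μ,ν)`: the set of non-negative Borel measures on `X × Y` with marginals `μ` and `ν`. -/
def IsCoupling {X Y : Type*} [MeasurableSpace X] [MeasurableSpace Y]
    (γ : Measure (X × Y)) (μ : Measure X) (ν : Measure Y) : Prop :=
  γ.map Prod.fst = μ ∧ γ.map Prod.snd = ν

/-- `γ` is extremal in the convex set `Γ(μ,ν)`. -/
def IsExtremalCoupling {X Y : Type*} [MeasurableSpace X] [MeasurableSpace Y]
    (γ : Measure (X × Y)) (μ : Measure X) (ν : Measure Y) : Prop :=
  IsCoupling γ μ ν ∧
    ∀ (γ₀ γ₁ : Measure (X × Y)) (t : ℝ≥0), 0 < t → t < 1 →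
      IsCoupling γ₀ μ ν → IsCoupling γ₁ μ ν →
      γ = (1 - t) • γ₀ + t • γ₁ → γ₀ = γ₁

/-- A signed perturbation of a finite measure by a functional of norm at most one on `L¹` is
again a finite measure. -/
lemma exists_measure_real_eq_add_dual {α : Type*} [MeasurableSpace α] (γ : Measure α)
    [IsFiniteMeasure γ] (φ : StrongDual ℝ (Lp ℝ 1 γ)) (hφ : ‖φ‖ ≤ 1) :
    ∃ m : Measure α, IsFiniteMeasure m ∧ ∀ (A : Set α) (hA : MeasurableSet A),
      m.real A = γ.real A + φ (indicatorConstLp 1 hA (measure_ne_top γ A) 1) := by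
  classical
  have hbound : ∀ (A : Set α) (hA : MeasurableSet A),
      ‖φ (indicatorConstLp 1 hA (measure_ne_top γ A) 1)‖ ≤ γ.real A := by
    intro A hA
    refine (φ.le_of_opNorm_le hφ _).trans ?_
    rw [norm_indicatorConstLp one_ne_zero ENNReal.one_ne_top]
    simp
  let f : Set α → ℝ := fun A ↦
    if hA : MeasurableSet A then φ (indicatorConstLp 1 hA (measure_ne_top γ A) 1) else 0
  have hf : ∀ (A : Set α) (hA : MeasurableSet A),
      f A = φ (indicatorConstLp 1 hA (measure_ne_top γ A) 1) := fun A hA ↦ dif_pos hA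
  let s : SignedMeasure α := VectorMeasure.of_additive_of_le_measure (μ := γ) f
    (by
      intro A
      by_cases hA : MeasurableSet A
      · rw [hf A hA, ← ofReal_norm, ← ofReal_measureReal]
        exact ENNReal.ofReal_le_ofReal (hbound A hA)
      · simp [f, hA])
    (by
      intro A B hA hB hAB
      rw [hf _ (hA.union hB), hf A hA, hf B hB, ← map_add,
        indicatorConstLp_disjoint_union hA hB (measure_ne_top γ A) (measure_ne_top γ B) hAB])
    (fun A hA ↦ dif_neg hA)
  have hpos : 0 ≤[Set.univ] (γ.toSignedMeasure + s) := by
    rw [VectorMeasure.le_restrict_univ_iff_le]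
    intro A hA
    have h1 := (abs_le.1 (hbound A hA)).1
    have h2 : s A = φ (indicatorConstLp 1 hA (measure_ne_top γ A) 1) := hf A hA
    simp only [FunLike.coe_zero, Pi.zero_apply, add_apply, h2,
      Measure.toSignedMeasure_apply_measurable hA]
    linarith
  refine ⟨(γ.toSignedMeasure + s).toMeasureOfZeroLE Set.univ MeasurableSet.univ hpos,
    inferInstance, fun A hA ↦ ?_⟩
  rw [SignedMeasure.toMeasureOfZeroLE_real_apply _ _ _ hA, Set.univ_inter,
    add_apply, Measure.toSignedMeasure_apply_measurable hA]
  congr 1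
  exact hf A hA

/-- A continuous functional on `L¹` that vanishes on indicators is zero. -/
lemma dual_L1_eq_zero {α : Type*} [MeasurableSpace α] {γ : Measure α} [IsFiniteMeasure γ]
    (φ : StrongDual ℝ (Lp ℝ 1 γ))
    (hφ : ∀ (A : Set α) (hA : MeasurableSet A),
      φ (indicatorConstLp 1 hA (measure_ne_top γ A) 1) = 0) : φ = 0 := by
  ext f
  induction f using Lp.induction ENNReal.one_ne_top with
  | indicatorConst c hs hμs =>
    rename_i s
    have : indicatorConstLp 1 hs hμs.ne c =
        c • indicatorConstLp 1 hs (measure_ne_top γ s) (1 : ℝ) := by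
      ext1
      grw [Lp.coeFn_smul, indicatorConstLp_coeFn, indicatorConstLp_coeFn]
      refine .of_forall fun x ↦ ?_
      by_cases hx : x ∈ s <;> simp [hx]
    rw [Lp.simpleFunc.coe_indicatorConst, this, map_smul, hφ s hs]
    simp
  | add hf hg _ h1 h2 => rw [map_add, h1, h2, map_add]
  | isClosed => exact isClosed_eq φ.continuous continuous_const

/-- A measure with the same mass as a coupling on all cylinders is a coupling. -/
lemma IsCoupling.of_real_preimage_eq {X Y : Type*} [MeasurableSpace X] [MeasurableSpace Y]
    {γ m : Measure (X × Y)} [IsFiniteMeasure γ] [IsFiniteMeasure m] {μ : Measure X}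
    {ν : Measure Y} (hγ : IsCoupling γ μ ν)
    (hfst : ∀ B : Set X, MeasurableSet B → m.real (Prod.fst ⁻¹' B) = γ.real (Prod.fst ⁻¹' B))
    (hsnd : ∀ B : Set Y, MeasurableSet B → m.real (Prod.snd ⁻¹' B) = γ.real (Prod.snd ⁻¹' B)) :
    IsCoupling m μ ν := by
  refine ⟨hγ.1 ▸ ?_, hγ.2 ▸ ?_⟩
  · ext B hB
    rw [Measure.map_apply measurable_fst hB, Measure.map_apply measurable_fst hB]
    exact (measureReal_eq_measureReal_iff).1 (hfst B hB)
  · ext B hB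
    rw [Measure.map_apply measurable_snd hB, Measure.map_apply measurable_snd hB]
    exact (measureReal_eq_measureReal_iff).1 (hsnd B hB)

/-- A continuous functional on `L¹(γ)`, `γ` extremal, that vanishes on cylinders is zero. -/
lemma IsExtremalCoupling.dual_eq_zero {X Y : Type*} [MeasurableSpace X] [MeasurableSpace Y]
    {γ : Measure (X × Y)} [IsFiniteMeasure γ] {μ : Measure X} {ν : Measure Y}
    (hγ : IsExtremalCoupling γ μ ν) (φ : StrongDual ℝ (Lp ℝ 1 γ))
    (hfst : ∀ (B : Set X) (hB : MeasurableSet B),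
      φ (indicatorConstLp 1 (measurable_fst hB) (measure_ne_top γ _) 1) = 0)
    (hsnd : ∀ (B : Set Y) (hB : MeasurableSet B),
      φ (indicatorConstLp 1 (measurable_snd hB) (measure_ne_top γ _) 1) = 0) : φ = 0 := by
  wlog hφ : ‖φ‖ ≤ 1 generalizing φ
  · have hne : ‖φ‖ ≠ 0 := by
      intro h
      rw [h] at hφ
      exact hφ zero_le_one
    have := this (‖φ‖⁻¹ • φ) (fun B hB ↦ by simp [hfst B hB]) (fun B hB ↦ by simp [hsnd B hB])
      (by rw [norm_smul, norm_inv, norm_norm, inv_mul_cancel₀ hne])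
    exact (smul_eq_zero.1 this).resolve_left (inv_ne_zero hne)
  obtain ⟨m₀, hm₀, h₀⟩ := exists_measure_real_eq_add_dual γ φ hφ
  obtain ⟨m₁, hm₁, h₁⟩ := exists_measure_real_eq_add_dual γ (-φ) (by rwa [norm_neg])
  have c₀ : IsCoupling m₀ μ ν := hγ.1.of_real_preimage_eq
    (fun B hB ↦ by rw [h₀ _ (measurable_fst hB), hfst B hB, add_zero])
    (fun B hB ↦ by rw [h₀ _ (measurable_snd hB), hsnd B hB, add_zero])
  have c₁ : IsCoupling m₁ μ ν := hγ.1.of_real_preimage_eq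
    (fun B hB ↦ by
      rw [h₁ _ (measurable_fst hB), neg_apply, hfst B hB, neg_zero, add_zero])
    (fun B hB ↦ by
      rw [h₁ _ (measurable_snd hB), neg_apply, hsnd B hB, neg_zero, add_zero])
  have half_pos : (0 : ℝ≥0) < 2⁻¹ := by positivity
  have half_lt : (2⁻¹ : ℝ≥0) < 1 := inv_lt_one_of_one_lt₀ one_lt_two
  have hsub : (1 - 2⁻¹ : ℝ≥0) = 2⁻¹ := by
    ext
    rw [NNReal.coe_sub half_lt.le]
    norm_num
  have heq : m₀ = m₁ := by
    refine hγ.2 m₀ m₁ 2⁻¹ half_pos half_lt c₀ c₁ ?_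
    rw [hsub]
    ext A hA
    refine (measureReal_eq_measureReal_iff).1 ?_
    rw [measureReal_add_apply, measureReal_nnreal_smul_apply, measureReal_nnreal_smul_apply,
      h₀ A hA, h₁ A hA, neg_apply]
    push_cast
    ring
  refine dual_L1_eq_zero φ fun A hA ↦ ?_
  have h2 := h₁ A hA
  rw [← heq, h₀ A hA, neg_apply] at h2
  linarith

/-- A subspace of a real normed space is dense if every continuous functional vanishing on it
is zero. -/
lemma Submodule.mem_closure_of_forall_dual_eq_zero {E : Type*} [NormedAddCommGroup E]
    [NormedSpace ℝ E] (S : Submodule ℝ E)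
    (hS : ∀ φ : StrongDual ℝ E, (∀ x ∈ S, φ x = 0) → φ = 0) (x : E) :
    x ∈ closure (S : Set E) := by
  by_contra hx
  obtain ⟨φ, r, hr, hrx⟩ := geometric_hahn_banach_closed_point S.convex.closure isClosed_closure hx
  have hr0 : 0 < r := by simpa using hr 0 (subset_closure S.zero_mem)
  have : φ = 0 := by
    refine hS φ fun y hy ↦ ?_
    by_contra hne
    have := hr ((r / φ y) • y) (subset_closure (S.smul_mem _ hy))
    rw [map_smul, smul_eq_mul, div_mul_cancel₀ _ hne] at this
    exact lt_irrefl _ this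
  rw [this, zero_apply] at hrx
  exact hr0.not_gt hrx

lemma IsExtremalCoupling.exists_integral_abs_sub_lt {X Y : Type*} [MeasurableSpace X]
    [MeasurableSpace Y] {γ : Measure (X × Y)} {μ : Measure X} {ν : Measure Y}
    [IsFiniteMeasure γ] [IsFiniteMeasure μ] [IsFiniteMeasure ν]
    (hγ : IsExtremalCoupling γ μ ν) {h : X × Y → ℝ} (hh : Integrable h γ) {ε : ℝ} (hε : 0 < ε) :
    ∃ (u : X → ℝ) (v : Y → ℝ), Integrable u μ ∧ Integrable v ν ∧
      ∫ p, |h p - (u p.1 + v p.2)| ∂γ < ε := by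
  have hfst : MeasurePreserving Prod.fst γ μ := ⟨measurable_fst, hγ.1.1⟩
  have hsnd : MeasurePreserving Prod.snd γ ν := ⟨measurable_snd, hγ.1.2⟩
  let T : (Lp ℝ 1 μ × Lp ℝ 1 ν) →ₗ[ℝ] Lp ℝ 1 γ :=
    (Lp.compMeasurePreservingₗ ℝ Prod.fst hfst).coprod (Lp.compMeasurePreservingₗ ℝ Prod.snd hsnd)
  have hT : ∀ f g, T (f, g) =
      Lp.compMeasurePreserving Prod.fst hfst f + Lp.compMeasurePreserving Prod.snd hsnd g :=
    fun f g ↦ rfl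
  have hdense := T.range.mem_closure_of_forall_dual_eq_zero (fun φ hφ ↦ by
    refine hγ.dual_eq_zero φ (fun B hB ↦ ?_) (fun B hB ↦ ?_)
    · refine hφ _ ⟨(indicatorConstLp 1 hB (measure_ne_top μ B) 1, 0), ?_⟩
      rw [hT, map_zero, add_zero]
      exact Lp.indicatorConstLp_compMeasurePreserving hB (measure_ne_top μ B) 1 hfst
    · refine hφ _ ⟨(0, indicatorConstLp 1 hB (measure_ne_top ν B) 1), ?_⟩
      rw [hT, map_zero, zero_add]
      exact Lp.indicatorConstLp_compMeasurePreserving hB (measure_ne_top ν B) 1 hsnd)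
    hh.toL1
  obtain ⟨_, ⟨⟨f, g⟩, rfl⟩, hd⟩ := Metric.mem_closure_iff.1 hdense ε hε
  refine ⟨f, g, L1.integrable_coeFn f, L1.integrable_coeFn g, ?_⟩
  rw [dist_eq_norm, L1.norm_eq_integral_norm] at hd
  refine (integral_congr_ae ?_).trans_lt hd
  filter_upwards [Lp.coeFn_sub hh.toL1 (T (f, g)), hh.coeFn_toL1,
    Lp.coeFn_add (Lp.compMeasurePreserving Prod.fst hfst f)
      (Lp.compMeasurePreserving Prod.snd hsnd g),
    Lp.coeFn_compMeasurePreserving f hfst, Lp.coeFn_compMeasurePreserving g hsnd]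
    with p h1 h2 h3 h4 h5
  rw [h1, Pi.sub_apply, h2, hT, h3, Pi.add_apply, h4, h5, Real.norm_eq_abs]
  rfl

/-- A coupling dominated by a multiple of `γ` is determined by approximations in `L¹(γ)`. -/
lemma IsCoupling.abs_real_sub_le {X Y : Type*} [MeasurableSpace X] [MeasurableSpace Y]
    {γ m : Measure (X × Y)} {μ : Measure X} {ν : Measure Y} [IsFiniteMeasure γ]
    (hγ : IsCoupling γ μ ν) (hm : IsCoupling m μ ν) {c : ℝ≥0} (hc : 0 < c) (hle : c • m ≤ γ)
    {A : Set (X × Y)} (hA : MeasurableSet A) {u : X → ℝ} {v : Y → ℝ}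
    (hu : Integrable u μ) (hv : Integrable v ν) :
    c * |m.real A - (∫ x, u x ∂μ + ∫ y, v y ∂ν)| ≤
      ∫ p, |A.indicator 1 p - (u p.1 + v p.2)| ∂γ := by
  have pres {κ : Measure (X × Y)} (hκ : IsCoupling κ μ ν) :
      MeasurePreserving Prod.fst κ μ ∧ MeasurePreserving Prod.snd κ ν :=
    ⟨⟨measurable_fst, hκ.1⟩, ⟨measurable_snd, hκ.2⟩⟩
  obtain ⟨hm₁, hm₂⟩ := pres hm
  obtain ⟨hγ₁, hγ₂⟩ := pres hγ
  have hA' : Integrable (A.indicator (1 : X × Y → ℝ)) γ :=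
    (integrable_const (1 : ℝ)).indicator hA
  have hint : Integrable (fun p : X × Y ↦ A.indicator 1 p - (u p.1 + v p.2)) γ :=
    hA'.sub ((hγ₁.integrable_comp_of_integrable hu).add (hγ₂.integrable_comp_of_integrable hv))
  have hAm : Integrable (A.indicator (1 : X × Y → ℝ)) m :=
    (integrable_smul_measure (ENNReal.coe_ne_zero.2 hc.ne') ENNReal.coe_ne_top).1
      (hA'.mono_measure hle)
  have hum : Integrable (fun p : X × Y ↦ u p.1) m := hm₁.integrable_comp_of_integrable hu
  have hvm : Integrable (fun p : X × Y ↦ v p.2) m := hm₂.integrable_comp_of_integrable hv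
  have hval : ∫ p, (A.indicator 1 p - (u p.1 + v p.2)) ∂m =
      m.real A - (∫ x, u x ∂μ + ∫ y, v y ∂ν) := by
    have hu_eq : ∫ x, u x ∂μ = ∫ p, u p.1 ∂m := by
      rw [← hm.1, integral_map measurable_fst.aemeasurable (by rw [hm.1]; exact hu.1)]
    have hv_eq : ∫ y, v y ∂ν = ∫ p, v p.2 ∂m := by
      rw [← hm.2, integral_map measurable_snd.aemeasurable (by rw [hm.2]; exact hv.1)]
    rw [hu_eq, hv_eq, ← integral_indicator_one hA, ← integral_add hum hvm]
    exact integral_sub hAm (hum.add hvm)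
  calc c * |m.real A - (∫ x, u x ∂μ + ∫ y, v y ∂ν)|
      ≤ c * ∫ p, |A.indicator 1 p - (u p.1 + v p.2)| ∂m := by
        rw [← hval]
        gcongr
        exact abs_integral_le_integral_abs
    _ = ∫ p, |A.indicator 1 p - (u p.1 + v p.2)| ∂(c • m) := by
        rw [integral_smul_nnreal_measure]
        rfl
    _ ≤ ∫ p, |A.indicator 1 p - (u p.1 + v p.2)| ∂γ :=
        integral_mono_measure hle (Filter.Eventually.of_forall fun _ ↦ abs_nonneg _) hint.abs

lemma IsCoupling.isExtremalCoupling_of_dense_sums {X Y : Type*} [MeasurableSpace X]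
    [MeasurableSpace Y] {γ : Measure (X × Y)} {μ : Measure X} {ν : Measure Y}
    [IsFiniteMeasure γ] (hγ : IsCoupling γ μ ν)
    (hdense : ∀ h : X × Y → ℝ, Integrable h γ → ∀ ε : ℝ, 0 < ε →
      ∃ (u : X → ℝ) (v : Y → ℝ), Integrable u μ ∧ Integrable v ν ∧
        ∫ p, |h p - (u p.1 + v p.2)| ∂γ < ε) :
    IsExtremalCoupling γ μ ν := by
  refine ⟨hγ, fun γ₀ γ₁ t ht ht1 h₀ h₁ heq ↦ ?_⟩
  have finite {κ : Measure (X × Y)} (hκ : IsCoupling κ μ ν) : IsFiniteMeasure κ := by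
    constructor
    have := congrArg (· Set.univ) (hκ.1.trans hγ.1.symm)
    simp only [Measure.map_apply measurable_fst MeasurableSet.univ, Set.preimage_univ] at this
    rw [this]
    exact measure_lt_top γ _
  have := finite h₀
  have := finite h₁
  have ht' : 0 < 1 - t := tsub_pos_of_lt ht1
  have hle₀ : (1 - t) • γ₀ ≤ γ := heq ▸ Measure.le_add_right le_rfl
  have hle₁ : t • γ₁ ≤ γ := heq ▸ Measure.le_add_left le_rfl
  ext A hA
  refine (measureReal_eq_measureReal_iff).1 ?_
  refine eq_of_forall_dist_le fun δ hδ ↦ ?_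
  have hA' : Integrable (A.indicator (1 : X × Y → ℝ)) γ :=
    (integrable_const (1 : ℝ)).indicator hA
  obtain ⟨c, hc, hc₀, hc₁⟩ : ∃ c : ℝ≥0, 0 < c ∧ c ≤ 1 - t ∧ c ≤ t :=
    ⟨min (1 - t) t, lt_min ht' ht, min_le_left _ _, min_le_right _ _⟩
  have hcpos : (0 : ℝ) < c := hc
  obtain ⟨u, v, hu, hv, huv⟩ := hdense _ hA' (c * (δ / 2)) (by positivity)
  have close {κ : Measure (X × Y)} (hκ : IsCoupling κ μ ν) {s : ℝ≥0} (hs : s • κ ≤ γ)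
      (hcs : c ≤ s) : |κ.real A - (∫ x, u x ∂μ + ∫ y, v y ∂ν)| < δ / 2 := by
    have h := hγ.abs_real_sub_le hκ (hc.trans_le hcs) hs hA hu hv
    have hcs' : (c : ℝ) ≤ s := hcs
    refine lt_of_mul_lt_mul_left (lt_of_le_of_lt (le_trans ?_ h) huv) hcpos.le
    gcongr
  have e₀ := abs_lt.1 (close h₀ hle₀ hc₀)
  have e₁ := abs_lt.1 (close h₁ hle₁ hc₁)
  rw [Real.dist_eq]
  exact abs_le.2 ⟨by linarith [e₀.1, e₁.2], by linarith [e₀.2, e₁.1]⟩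

/-- **Douglas–Lindenstrauss characterization of extremality.**  A measure `γ ∈ Γ(μ,ν)` is
extremal if and only if the subspace `{(x,y) ↦ u(x) + v(y) : u ∈ L¹(μ), v ∈ L¹(ν)}` is
dense in `L¹(X × Y, dγ)`: every `h ∈ L¹(γ)` can be approximated in the `L¹(γ)` norm by
functions of the form `u(x) + v(y)`. -/
theorem isExtremalCoupling_iff_dense_sums
    {X Y : Type*}
    [MetricSpace X] [TopologicalSpace.SeparableSpace X] [MeasurableSpace X] [BorelSpace X]
    [MetricSpace Y] [TopologicalSpace.SeparableSpace Y] [MeasurableSpace Y] [BorelSpace Y]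
    (μ : Measure X) (ν : Measure Y) [IsProbabilityMeasure μ] [IsProbabilityMeasure ν]
    (γ : Measure (X × Y)) (hγ : IsCoupling γ μ ν) :
    IsExtremalCoupling γ μ ν ↔
      ∀ h : X × Y → ℝ, Integrable h γ → ∀ ε : ℝ, 0 < ε →
        ∃ (u : X → ℝ) (v : Y → ℝ), Integrable u μ ∧ Integrable v ν ∧
          ∫ p, |h p - (u p.1 + v p.2)| ∂γ < ε := by
  have : IsFiniteMeasure γ := by
    constructor
    have h := measure_lt_top μ Set.univ
    rwa [← hγ.1, Measure.map_apply measurable_fst MeasurableSet.univ, Set.preimage_univ] at h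
  exact ⟨fun h _ hf _ hε ↦ h.exists_integral_abs_sub_lt hf hε,
    hγ.isExtremalCoupling_of_dense_sums⟩
end
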